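/- Every product vector in the range of ρ3 is a multiple of e_{(0,2)} or of e_{(2,0)}: if ψ ∈ ℂ^(Fin 3 × Fin 3) lies in the range (column space) of ρ3 and has Schmidt rank at most 1, then there exists c ∈ ℂ with ψ = c·e_{(0,2)} or ψ = c·e_{(2,0)}. -/

import Mathlib

open Matrix Kronecker ComplexOrder

/-- The Schmidt rank of a vector `ψ ∈ ℂ^(Fin m × Fin n)`: the rank of the associated
`m × n` matrix with `(i,j)` entry `ψ (i,j)`. -/
noncomputable def schmidtRank {m n : ℕ} (ψ : Fin m × Fin n → ℂ) : ℕ :=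
  (Matrix.of fun i j => ψ (i, j) : Matrix (Fin m) (Fin n) ℂ).rank

/-- Rank-one outer product `v v*`. -/
def outer {d : Type*} (v : d → ℂ) : Matrix d d ℂ :=
  Matrix.of fun a b => v a * star (v b)

/-- `SNle ρ k` : the Schmidt number of `ρ` is at most `k`, i.e. `ρ` is a finite sum of
outer products of vectors of Schmidt rank at most `k`. -/
def SNle {m n : ℕ} (ρ : Matrix (Fin m × Fin n) (Fin m × Fin n) ℂ) (k : ℕ) : Prop :=
  ∃ (T : ℕ) (v : Fin T → (Fin m × Fin n → ℂ)),
    (∀ t, schmidtRank (v t) ≤ k) ∧ ρ = ∑ t, outer (v t)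

/-- Partial transpose on the second (B) subsystem. -/
def ptB {m n : ℕ} (ρ : Matrix (Fin m × Fin n) (Fin m × Fin n) ℂ) :
    Matrix (Fin m × Fin n) (Fin m × Fin n) ℂ :=
  Matrix.of fun p q => ρ (p.1, q.2) (q.1, p.2)

/-- Partial transpose on the first (A) subsystem. -/
def ptA {m n : ℕ} (ρ : Matrix (Fin m × Fin n) (Fin m × Fin n) ℂ) :
    Matrix (Fin m × Fin n) (Fin m × Fin n) ℂ :=
  Matrix.of fun p q => ρ (q.1, p.2) (p.1, q.2)


/-- Standard basis vector of `ℂ^(Fin 3 × Fin 3)`. -/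
def eb (q : Fin 3 × Fin 3) : Fin 3 × Fin 3 → ℂ := fun p => if p = q then 1 else 0

/-- The generalized grid state `ρ^{3×3}`. -/
noncomputable def rho3 : Matrix (Fin 3 × Fin 3) (Fin 3 × Fin 3) ℂ :=
  outer (eb (0, 0) + eb (1, 1) + eb (2, 2))
  + outer (eb (0, 1) + eb (1, 2))
  + outer (eb (1, 0) - eb (2, 1))
  + (3 : ℂ) • outer (eb (0, 2))
  + (3 : ℂ) • outer (eb (2, 0))


theorem minor_zero (ψ : Fin 3 × Fin 3 → ℂ) (h : schmidtRank ψ ≤ 1) (i j k l : Fin 3) :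
    ψ (i, k) * ψ (j, l) = ψ (i, l) * ψ (j, k) := by
  by_contra hne
  have hdet : ((Matrix.of fun i j => ψ (i, j) : Matrix (Fin 3) (Fin 3) ℂ).submatrix ![i, j] ![k, l]).det ≠ 0 := by
    rw [Matrix.det_fin_two]
    simpa using sub_ne_zero.mpr hne
  have h1 := Matrix.rank_of_isUnit _ ((Matrix.isUnit_iff_isUnit_det _).mpr (isUnit_iff_ne_zero.mpr hdet))
  have h2 := Matrix.rank_submatrix_le (Matrix.of fun i j => ψ (i, j) : Matrix (Fin 3) (Fin 3) ℂ) ![i, j] ![k, l]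
  unfold schmidtRank at h
  simp only [Fintype.card_fin] at h1
  omega

/-- Every product vector in the range of `ρ^{3×3}` is a multiple of `e_{(0,2)}` or
`e_{(2,0)}`. -/
theorem rho3_product_vectors_in_range
    (ψ : Fin 3 × Fin 3 → ℂ) (hψ : ∃ x, rho3.mulVec x = ψ)
    (hSR : schmidtRank ψ ≤ 1) :
    ∃ c : ℂ, ψ = c • eb (0, 2) ∨ ψ = c • eb (2, 0) := by
  obtain ⟨x, hx⟩ := hψ
  have E : ∀ p, ψ p = (rho3.mulVec x) p := fun p => by rw [hx]
  have h11 : ψ (1, 1) = ψ (0, 0) := by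
    simp [E, rho3, Matrix.mulVec, dotProduct, Fintype.sum_prod_type, Fin.sum_univ_three, outer, eb]
  have h22 : ψ (2, 2) = ψ (0, 0) := by
    simp [E, rho3, Matrix.mulVec, dotProduct, Fintype.sum_prod_type, Fin.sum_univ_three, outer, eb]
  have h12 : ψ (1, 2) = ψ (0, 1) := by
    simp [E, rho3, Matrix.mulVec, dotProduct, Fintype.sum_prod_type, Fin.sum_univ_three, outer, eb]
  have h21 : ψ (2, 1) = - ψ (1, 0) := by
    simp [E, rho3, Matrix.mulVec, dotProduct, Fintype.sum_prod_type, Fin.sum_univ_three, outer, eb]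
    ring
  have m1 := minor_zero ψ hSR 0 1 0 1
  have m2 := minor_zero ψ hSR 1 2 1 2
  have m3 := minor_zero ψ hSR 0 1 1 2
  have m4 := minor_zero ψ hSR 1 2 0 1
  have m5 := minor_zero ψ hSR 0 2 0 2
  rw [h11] at m1
  rw [h11, h22, h12, h21] at m2
  rw [h11, h12] at m3
  rw [h11, h21] at m4
  rw [h22] at m5
  have a0 : ψ (0, 0) = 0 := by
    have : ψ (0, 0) * ψ (0, 0) = 0 := by linear_combination (m1 + m2) / 2
    simpa using this
  have b0 : ψ (0, 1) = 0 := by simpa [a0] using m3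
  have c0 : ψ (1, 0) = 0 := by simpa [a0] using m4
  have de : ψ (0, 2) = 0 ∨ ψ (2, 0) = 0 := by simpa [a0] using m5
  rcases de with d | d
  · refine ⟨ψ (2, 0), Or.inr ?_⟩
    ext ⟨i, j⟩
    fin_cases i <;> fin_cases j <;> simp [eb, h11, h22, h12, h21, a0, b0, c0, d]
  · refine ⟨ψ (0, 2), Or.inl ?_⟩
    ext ⟨i, j⟩
    fin_cases i <;> fin_cases j <;> simp [eb, h11, h22, h12, h21, a0, b0, c0, d]
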